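/- arXiv:1708.00723 — 6 statements merged into one kernel-verified Lean document; each statement's English description precedes it below -/
import Mathlib

section
/- Let f : ℂ → ℝ be given by f(z) = (3/2)·log(1 + |z|²) − log|z³ − 1| on U = {z ∈ ℂ : z³ ≠ 1}. For every z ∈ U, the (real) Fréchet derivative of f at z vanishes if and only if z = 0 or z³ = −1. In particular f has exactly four critical points in the affine chart: the point 0 and the three cube roots of −1. -/
open Complex

/-- The Kähler potential in the affine chart: f(z) = (3/2)·log(1+|z|²) − log|z³−1|. -/
noncomputable def kpot (z : ℂ) : ℝ :=
  (3 / 2) * Real.log (1 + ‖z‖ ^ 2) - Real.log ‖z ^ 3 - 1‖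

lemma kpot_hasFDerivAt (z : ℂ) (hz : z ^ 3 ≠ 1) :
    ∃ D : ℂ →L[ℝ] ℝ, HasFDerivAt kpot D z ∧ ∀ v, D v =
      ((3 * (starRingEnd ℂ) z / (1 + z * (starRingEnd ℂ) z) - 3 * z ^ 2 / (z ^ 3 - 1)) * v).re := by
  have hne : z ^ 3 - 1 ≠ 0 := sub_ne_zero.mpr hz
  have hk : kpot = fun w : ℂ => (3 / 2) * Real.log (1 + ‖w‖ ^ 2)
      - (1 / 2) * Real.log (‖w ^ 3 - 1‖ ^ 2) := by
    funext w
    rw [kpot, Real.log_pow]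
    push_cast
    ring
  have h1 : HasFDerivAt (fun w : ℂ => ‖w‖ ^ 2) _ z := (hasFDerivAt_id (𝕜 := ℝ) z).norm_sq
  have hp : HasFDerivAt (fun w : ℂ => w ^ 3 - 1) _ z :=
    (((hasDerivAt_pow 3 z).sub_const 1).hasFDerivAt).restrictScalars ℝ
  have h2 := hp.norm_sq
  have hpos : (1 + ‖z‖ ^ 2) ≠ 0 := by positivity
  have hpos2 : ‖z ^ 3 - 1‖ ^ 2 ≠ 0 := by
    have := norm_ne_zero_iff.mpr hne
    positivity
  have h3 := (((h1.const_add 1).log hpos).const_mul (3 / 2)).sub ((h2.log hpos2).const_mul (1 / 2))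
  rw [hk]
  refine ⟨_, h3, ?_⟩
  intro v
  have e1 : 3 * (starRingEnd ℂ) z / (1 + z * (starRingEnd ℂ) z) * v
      = (((1 + ‖z‖ ^ 2)⁻¹ * 3 : ℝ) : ℂ) * ((starRingEnd ℂ) z * v) := by
    rw [Complex.mul_conj, Complex.normSq_eq_norm_sq]
    push_cast
    ring
  have e2 : 3 * z ^ 2 / (z ^ 3 - 1) * v
      = (((‖z ^ 3 - 1‖ ^ 2)⁻¹ : ℝ) : ℂ) * ((starRingEnd ℂ) (z ^ 3 - 1) * (3 * z ^ 2 * v)) := by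
    rw [← Complex.normSq_eq_norm_sq]
    rw [div_eq_mul_inv, Complex.inv_def]
    ring
  rw [sub_mul, e1, e2, Complex.sub_re, Complex.re_ofReal_mul, Complex.re_ofReal_mul]
  simp [Complex.inner]
  ring

theorem critical_points_of_kpot :
    ∀ z : ℂ, z ^ 3 ≠ 1 →
      (fderiv ℝ kpot z = 0 ↔ z = 0 ∨ z ^ 3 = -1) := by
  intro z hz
  obtain ⟨D, hD, hv⟩ := kpot_hasFDerivAt z hz
  have hne : z ^ 3 - 1 ≠ 0 := sub_ne_zero.mpr hz
  have hpos : (1 + z * (starRingEnd ℂ) z) ≠ 0 := by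
    rw [Complex.mul_conj]
    have : (0 : ℝ) < 1 + Complex.normSq z := by
      have := Complex.normSq_nonneg z
      linarith
    exact_mod_cast this.ne'
  rw [hD.fderiv]
  set c := 3 * (starRingEnd ℂ) z / (1 + z * (starRingEnd ℂ) z) - 3 * z ^ 2 / (z ^ 3 - 1) with hc
  have hDc : D = 0 ↔ c = 0 := by
    constructor
    · intro h
      have h1 := hv ((starRingEnd ℂ) c)
      rw [h, Complex.mul_conj] at h1
      exact Complex.normSq_eq_zero.mp (by simpa using h1.symm)
    · intro h
      ext v
      rw [hv, h]
      simp
  have hcz : c = 0 ↔ (starRingEnd ℂ) z = - z ^ 2 := by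
    rw [hc, sub_eq_zero, div_eq_div_iff hpos hne]
    constructor
    · intro h
      linear_combination (-1 / 3 : ℂ) * h
    · intro h
      linear_combination (-3 : ℂ) * h
  rw [hDc, hcz]
  constructor
  · intro h
    by_cases h0 : z = 0
    · exact Or.inl h0
    · right
      have hn : ‖z‖ = ‖z‖ ^ 2 := by
        have := congrArg norm h
        simpa using this
      have hz0 : ‖z‖ ≠ 0 := norm_ne_zero_iff.mpr h0
      have h1 : ‖z‖ = 1 := by
        apply mul_left_cancel₀ hz0
        nlinarith
      have h2 : z * (starRingEnd ℂ) z = 1 := by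
        rw [Complex.mul_conj, Complex.normSq_eq_norm_sq, h1]
        simp
      rw [h] at h2
      linear_combination -h2
  · rintro (h | h)
    · simp [h]
    · have h0 : z ≠ 0 := by
        rintro rfl
        norm_num at h
      have h1 : ‖z‖ = 1 := by
        have h3 : ‖z‖ ^ 3 = 1 := by
          rw [← norm_pow, h]
          simp
        exact (pow_eq_one_iff_of_nonneg (norm_nonneg z) (by norm_num)).mp h3
      have h2 : z * (starRingEnd ℂ) z = 1 := by
        rw [Complex.mul_conj, Complex.normSq_eq_norm_sq, h1]
        simp
      apply mul_left_cancel₀ h0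
      linear_combination h2 + h
end

section
/- Let f : ℂ → ℝ be given by f(z) = (3/2)·log(1 + |z|²) − log|z³ − 1| on U = {z ∈ ℂ : z³ ≠ 1}. For every s ∈ ℂ with s³ = −1, the point s is neither a local minimum nor a local maximum of f (restricted to U); i.e., the three critical points at the cube roots of −1 are saddle points. -/
open Complex

lemma curve_aux (P : ℂ → Prop) (S : Set ℂ) (s : ℂ) (h : ∀ᶠ z in nhdsWithin s S, P z)
    (c : ℝ → ℂ) (hc : Continuous c) (h0 : c 0 = s) :
    ∃ t : ℝ, 0 < t ∧ t < 1 ∧ (c t ∈ S → P (c t)) := by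
  rw [eventually_nhdsWithin_iff, ← h0] at h
  have h1 := (hc.tendsto 0).eventually h
  have h2 : ∀ᶠ t : ℝ in nhdsWithin 0 (Set.Ioi 0), (c t ∈ S → P (c t)) :=
    h1.filter_mono nhdsWithin_le_nhds
  have h3 : ∀ᶠ t : ℝ in nhdsWithin 0 (Set.Ioi 0), t ∈ Set.Ioo (0:ℝ) 1 :=
    Ioo_mem_nhdsGT one_pos
  obtain ⟨t, ht, ht'⟩ := (h2.and h3).exists
  exact ⟨t, ht'.1, ht'.2, ht⟩

theorem kpot_saddle_at_cube_roots_of_neg_one :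
    ∀ s : ℂ, s ^ 3 = -1 →
      ¬ IsLocalMinOn kpot {z : ℂ | z ^ 3 ≠ 1} s ∧
        ¬ IsLocalMaxOn kpot {z : ℂ | z ^ 3 ≠ 1} s := by
  intro s hs
  have hn : ‖s‖ = 1 := by
    have : ‖s‖ ^ 3 = 1 := by rw [← norm_pow, hs]; simp
    exact (pow_eq_one_iff_of_nonneg (norm_nonneg _) (by norm_num)).1 this
  have hks : kpot s = (3 / 2) * Real.log 2 - Real.log 2 := by
    have : ‖(-1 - 1 : ℂ)‖ = 2 := by norm_num
    rw [kpot, hs, hn, this]; norm_num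
  constructor
  · intro h
    obtain ⟨t, ht0, ht1, ht⟩ := curve_aux _ _ s h (fun t : ℝ => ((1 + t : ℝ) : ℂ) * s)
      (by fun_prop) (by simp)
    have hr : 0 < 1 + t := by linarith
    generalize hrt : 1 + t = r at *
    have e : ((r : ℂ) * s) ^ 3 = ((-r ^ 3 : ℝ) : ℂ) := by
      rw [mul_pow, hs]; push_cast; ring
    have e2 : ((r : ℂ) * s) ^ 3 - 1 = ((-(1 + r ^ 3) : ℝ) : ℂ) := by
      rw [e]; push_cast; ring
    have hr3 : 0 < r ^ 3 := by positivity
    have hle := ht (by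
      simp only [Set.mem_setOf_eq]
      rw [e]
      intro h
      have : -r ^ 3 = (1:ℝ) := by exact_mod_cast h
      linarith)
    rw [hks, kpot, e2, norm_mul, hn, Complex.norm_real, Complex.norm_real, norm_neg,
      Real.norm_of_nonneg hr.le, Real.norm_of_nonneg (by linarith), mul_one] at hle
    have key : (1 + r ^ 2) ^ 3 < 2 * (1 + r ^ 3) ^ 2 := by
      have : 0 < (r - 1) ^ 2 * (r ^ 4 + 2 * r ^ 3 + 2 * r + 1) := by
        have : 0 < r - 1 := by linarith
        positivity
      nlinarith
    have hl := Real.log_lt_log (by positivity) key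
    rw [Real.log_mul (by norm_num) (by positivity), Real.log_pow, Real.log_pow] at hl
    push_cast at hl
    linarith
  · intro h
    obtain ⟨t, ht0, ht1, ht⟩ := curve_aux _ _ s h (fun t : ℝ => Complex.exp (t * I) * s)
      (by fun_prop) (by simp)
    have e : (Complex.exp (t * I) * s) ^ 3 = -Complex.exp ((3 * t : ℝ) * I) := by
      rw [mul_pow, hs, ← Complex.exp_nat_mul]; push_cast; ring_nf
    have hpi := Real.pi_gt_three
    have c1 : Real.cos (3 * t) < 1 := by
      have := Real.cos_lt_cos_of_nonneg_of_le_pi le_rfl (by linarith : 3 * t ≤ Real.pi) (by linarith)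
      simpa using this
    have c2 : -1 < Real.cos (3 * t) := by
      have := Real.cos_lt_cos_of_nonneg_of_le_pi (by linarith : 0 ≤ 3 * t) le_rfl (by linarith)
      simpa using this
    have hN : ‖-Complex.exp ((3 * t : ℝ) * I) - 1‖ ^ 2 = 2 + 2 * Real.cos (3 * t) := by
      rw [Complex.sq_norm, Complex.normSq_apply, Complex.sub_re, Complex.sub_im, Complex.neg_re,
        Complex.neg_im, Complex.exp_ofReal_mul_I_re, Complex.exp_ofReal_mul_I_im,
        Complex.one_re, Complex.one_im]
      nlinarith [Real.sin_sq_add_cos_sq (3 * t)]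
    have hpos : 0 < ‖-Complex.exp ((3 * t : ℝ) * I) - 1‖ := by
      rcases (norm_nonneg (-Complex.exp ((3 * t : ℝ) * I) - 1)).eq_or_lt with h | h
      · rw [← h] at hN; linarith
      · exact h
    have hlt : ‖-Complex.exp ((3 * t : ℝ) * I) - 1‖ < 2 := by nlinarith
    have hle := ht (by
      simp only [Set.mem_setOf_eq]
      rw [e]
      intro h
      rw [h] at hpos
      simp at hpos)
    rw [hks, kpot, e, norm_mul, hn, Complex.norm_exp_ofReal_mul_I] at hle
    have hl := Real.log_lt_log hpos hlt
    norm_num at hle hl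
    linarith
end

section
/- Let f : ℂ → ℝ be given by f(z) = (3/2)·log(1 + |z|²) − log|z³ − 1| on U = {z ∈ ℂ : z³ ≠ 1}. For every ζ ∈ ℂ with ζ³ = −1 and every t > 0, the gradient of f at t·ζ (with respect to the standard real inner product on ℂ ≅ ℝ²) is a real scalar multiple of ζ. In particular each ray {t·ζ : t > 0} with ζ³ = −1 is invariant under the gradient flow of f. -/
open Complex

/-- Along each ray through a cube root ζ of −1, the gradient of `kpot` (for the standard
real inner product on ℂ ≅ ℝ²) is a real multiple of ζ; hence the ray is invariant under
the gradient flow. -/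
theorem kpot_gradient_along_saddle_rays :
    ∀ ζ : ℂ, ζ ^ 3 = -1 → ∀ t : ℝ, 0 < t →
      ∃ c : ℝ, gradient kpot (t • ζ) = c • ζ := by
  intro ζ hζ t _
  have hn : ‖ζ‖ = 1 := by
    have h : ‖ζ‖ ^ 3 = 1 := by rw [← norm_pow, hζ]; simp
    exact (pow_eq_one_iff_of_nonneg (norm_nonneg _) (by norm_num)).1 h
  have hc : ζ * (starRingEnd ℂ) ζ = 1 := by
    rw [Complex.mul_conj, Complex.normSq_eq_norm_sq, hn]; simp
  have hn2 : ‖ζ ^ 2‖ = 1 := by rw [norm_pow, hn]; simp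
  let a : Circle := ⟨ζ ^ 2, mem_sphere_zero_iff_norm.2 hn2⟩
  let R : ℂ ≃L[ℝ] ℂ := (Complex.conjLIE.trans (rotation a)).toContinuousLinearEquiv
  have hR : ∀ z, R z = ζ ^ 2 * (starRingEnd ℂ) z := fun z => rfl
  have hinv : kpot ∘ R = kpot := by
    funext z
    have h3 : (ζ ^ 2 * (starRingEnd ℂ) z) ^ 3 - 1 = (starRingEnd ℂ) (z ^ 3 - 1) := by
      rw [map_sub, map_pow, map_one]
      linear_combination ((starRingEnd ℂ) z) ^ 3 * (ζ ^ 3 - 1) * hζ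
    simp only [Function.comp, kpot, hR]
    rw [h3, norm_mul, hn2, Complex.norm_conj, Complex.norm_conj, one_mul]
  have hfix : R (t • ζ) = t • ζ := by
    rw [hR]
    simp only [Complex.real_smul, map_mul, Complex.conj_ofReal]
    linear_combination (t * ζ : ℂ) * hc
  have hI : R (Complex.I * ζ) = -(Complex.I * ζ) := by
    rw [hR, map_mul, Complex.conj_I]
    linear_combination (-Complex.I * ζ : ℂ) * hc
  have hD := R.comp_right_fderiv (f := kpot) (x := t • ζ)
  rw [hinv, hfix] at hD
  have hv := congrArg (fun L : ℂ →L[ℝ] ℝ => L (Complex.I * ζ)) hD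
  simp only [ContinuousLinearMap.comp_apply, ContinuousLinearEquiv.coe_coe, hI, map_neg] at hv
  have h0 : fderiv ℝ kpot (t • ζ) (Complex.I * ζ) = 0 := by linarith
  have hg : inner ℝ (gradient kpot (t • ζ)) (Complex.I * ζ) = 0 := by
    rw [gradient, InnerProductSpace.toDual_symm_apply, h0]
  generalize gradient kpot (t • ζ) = g at hg ⊢
  refine ⟨(g * (starRingEnd ℂ) ζ).re, ?_⟩
  have him : (g * (starRingEnd ℂ) ζ).im = 0 := by
    rw [Complex.inner] at hg
    simp at hg ⊢
    linarith
  have : (((g * (starRingEnd ℂ) ζ).re : ℝ) : ℂ) = g * (starRingEnd ℂ) ζ :=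
    Complex.ext (by simp) (by rw [him]; simp)
  rw [Complex.real_smul, this]
  linear_combination -g * hc
end

section
/- Let λ be the real 1-form on U = {z ∈ ℂ : z³ ≠ 1} given by λ_z(v) = −Im((3·conj(z)/(1 + |z|²) − 3z²/(z³ − 1))·v). For r > 0 with r ≠ 1, let I(r) = ∫₀^{2π} λ_{γ(θ)}(γ'(θ)) dθ be the integral of λ over the circle γ(θ) = r·e^{iθ}. Then I(r) = −6π·r²/(1 + r²) if r < 1, and I(r) = 6π/(1 + r²) if r > 1. In particular I(r) ≠ 0 for every r ≠ 1, so no round circle centered at the origin is an exact loop in the complement. -/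
open Complex Real

/-- The Liouville 1-form of the Weinstein structure on U = {z | z³ ≠ 1}, evaluated at
the point `z` on the tangent vector `v`:
λ_z(v) = −Im((3·conj z/(1+|z|²) − 3z²/(z³−1))·v). -/
noncomputable def liouville (z v : ℂ) : ℝ :=
  -((3 * (starRingEnd ℂ) z / ((1 + ‖z‖ ^ 2 : ℝ) : ℂ)
      - 3 * z ^ 2 / (z ^ 3 - 1)) * v).im

lemma aux_int (s c : ℝ) (hs0 : 0 < s) (hs : s < 1) (n : ℤ) :
    (∫ θ in (0:ℝ)..(2 * π), (c + (-(n : ℂ) * Complex.I * (s * Complex.exp (n * (θ * Complex.I))) /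
      (1 - s * Complex.exp (n * (θ * Complex.I)))).im)) = 2 * π * c := by
  have hnorm : ∀ θ : ℝ, ‖(s : ℂ) * Complex.exp (n * (θ * Complex.I))‖ < 1 := by
    intro θ
    have h : (n : ℂ) * (θ * Complex.I) = ((n * θ : ℝ) : ℂ) * Complex.I := by push_cast; ring
    rw [norm_mul, h, Complex.norm_exp_ofReal_mul_I, Complex.norm_real, Real.norm_eq_abs,
      abs_of_pos hs0]
    linarith
  have hsl : ∀ θ : ℝ, 1 - (s : ℂ) * Complex.exp (n * (θ * Complex.I)) ∈ Complex.slitPlane := by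
    intro θ
    rw [sub_eq_add_neg]
    apply Complex.mem_slitPlane_of_norm_lt_one
    rw [norm_neg]; exact hnorm θ
  have hd : ∀ θ : ℝ, HasDerivAt (fun θ : ℝ => c * θ +
      (Complex.log (1 - (s : ℂ) * Complex.exp (n * (θ * Complex.I)))).im)
      (c + (-(n : ℂ) * Complex.I * (s * Complex.exp (n * (θ * Complex.I))) /
      (1 - s * Complex.exp (n * (θ * Complex.I)))).im) θ := by
    intro θ
    have h0 : HasDerivAt (fun θ : ℝ => (n : ℂ) * ((θ : ℂ) * Complex.I)) (n * (1 * Complex.I)) θ :=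
      ((Complex.ofRealCLM.hasDerivAt (x := θ)).mul_const Complex.I).const_mul (n : ℂ)
    have h1 := ((h0.cexp.const_mul (s : ℂ)).const_sub 1).clog_real (hsl θ)
    have h2 := Complex.imCLM.hasFDerivAt.comp_hasDerivAt θ h1
    have h3 := ((hasDerivAt_id θ).const_mul c).add h2
    refine h3.congr_deriv ?_
    simp only [mul_one, Complex.imCLM_apply]
    congr 3
    ring
  rw [intervalIntegral.integral_eq_sub_of_hasDerivAt (fun θ _ => hd θ)]
  · have h : Complex.exp (n * (((2 * π : ℝ) : ℂ) * Complex.I)) = 1 := by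
      push_cast; exact Complex.exp_int_mul_two_pi_mul_I n
    rw [h]; simp; ring
  · apply Continuous.intervalIntegrable
    refine continuous_const.add (Complex.continuous_im.comp ?_)
    refine Continuous.div (by fun_prop) (by fun_prop) ?_
    intro θ
    exact Complex.slitPlane_ne_zero (hsl θ)

lemma aux_pt (r θ : ℝ) (hr : 0 < r) :
    liouville ((r : ℂ) * Complex.exp (θ * Complex.I))
            ((r : ℂ) * Complex.I * Complex.exp (θ * Complex.I)) =
    -3 * r ^ 2 / (1 + r ^ 2) + (3 * Complex.I * ((r : ℂ) * Complex.exp (θ * Complex.I)) ^ 3 /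
      (((r : ℂ) * Complex.exp (θ * Complex.I)) ^ 3 - 1)).im := by
  have hn : ‖(r : ℂ) * Complex.exp (θ * Complex.I)‖ = r := by
    rw [norm_mul, Complex.norm_exp_ofReal_mul_I, Complex.norm_real, Real.norm_eq_abs,
      abs_of_pos hr, mul_one]
  have hc : (starRingEnd ℂ) ((r : ℂ) * Complex.exp (θ * Complex.I)) *
      ((r : ℂ) * Complex.exp (θ * Complex.I)) = ((r ^ 2 : ℝ) : ℂ) := by
    rw [mul_comm, Complex.mul_conj, Complex.normSq_eq_norm_sq, hn]
  unfold liouville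
  rw [hn]
  have hv : (r : ℂ) * Complex.I * Complex.exp (θ * Complex.I) =
    ((r : ℂ) * Complex.exp (θ * Complex.I)) * Complex.I := by ring
  rw [hv]
  generalize (r : ℂ) * Complex.exp (θ * Complex.I) = z at *
  have : (3 * (starRingEnd ℂ) z / ((1 + r ^ 2 : ℝ) : ℂ) - 3 * z ^ 2 / (z ^ 3 - 1)) *
      (z * Complex.I) = ((3 * r ^ 2 / (1 + r ^ 2) : ℝ) : ℂ) * Complex.I -
        3 * Complex.I * z ^ 3 / (z ^ 3 - 1) := by
    have : (3 * (starRingEnd ℂ) z / ((1 + r ^ 2 : ℝ) : ℂ) - 3 * z ^ 2 / (z ^ 3 - 1)) *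
      (z * Complex.I) = 3 * ((starRingEnd ℂ) z * z) / ((1 + r ^ 2 : ℝ) : ℂ) * Complex.I -
        3 * Complex.I * z ^ 3 / (z ^ 3 - 1) := by ring
    rw [this, hc]; push_cast; ring
  rw [this, Complex.sub_im, Complex.im_ofReal_mul, Complex.I_im]
  ring

lemma aux_main (r : ℝ) (hr : 0 < r) (hr1 : r ≠ 1) :
    (∫ θ in (0:ℝ)..(2 * π),
          liouville ((r : ℂ) * Complex.exp (θ * Complex.I))
            ((r : ℂ) * Complex.I * Complex.exp (θ * Complex.I)))
        = (if r < 1 then -6 * π * r ^ 2 / (1 + r ^ 2) else 6 * π / (1 + r ^ 2)) := by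
  have hp : (1 + r ^ 2) ≠ 0 := by positivity
  have he : ∀ θ : ℝ, ((r : ℂ) * Complex.exp (θ * Complex.I)) ^ 3 =
      ((r ^ 3 : ℝ) : ℂ) * Complex.exp (((3 : ℤ) : ℂ) * (θ * Complex.I)) := by
    intro θ
    rw [mul_pow, Complex.exp_int_mul]; push_cast; norm_cast
  split_ifs with h
  · have h3 : r ^ 3 < 1 := pow_lt_one₀ hr.le h (by norm_num)
    have := aux_int (r ^ 3) (-3 * r ^ 2 / (1 + r ^ 2)) (by positivity) h3 3
    rw [show -6 * π * r ^ 2 / (1 + r ^ 2) = 2 * π * (-3 * r ^ 2 / (1 + r ^ 2)) by ring, ← this]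
    congr 1
    funext θ
    rw [aux_pt r θ hr, he θ]
    congr 2
    rw [← neg_sub, div_neg]
    push_cast
    ring
  · have hr' : 1 < r := lt_of_le_of_ne (not_lt.mp h) hr1.symm
    have h3 : (r ^ 3)⁻¹ < 1 := inv_lt_one_of_one_lt₀ (one_lt_pow₀ hr' (by norm_num))
    have := aux_int ((r ^ 3)⁻¹) (3 / (1 + r ^ 2)) (by positivity) h3 (-3)
    rw [show 6 * π / (1 + r ^ 2) = 2 * π * (3 / (1 + r ^ 2)) by ring, ← this]
    congr 1
    funext θ
    rw [aux_pt r θ hr, he θ]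
    have hu : (((r ^ 3)⁻¹ : ℝ) : ℂ) * Complex.exp (((-3 : ℤ) : ℂ) * (θ * Complex.I)) =
      (((r ^ 3 : ℝ) : ℂ) * Complex.exp (((3 : ℤ) : ℂ) * (θ * Complex.I)))⁻¹ := by
      rw [mul_inv, ← Complex.exp_neg]; push_cast; ring_nf
    rw [hu]
    have hn : ‖((r ^ 3 : ℝ) : ℂ) * Complex.exp (((3 : ℤ) : ℂ) * (θ * Complex.I))‖ = r ^ 3 := by
      rw [← he θ, norm_pow, norm_mul, Complex.norm_exp_ofReal_mul_I, Complex.norm_real,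
        Real.norm_eq_abs, abs_of_pos hr, mul_one]
    generalize ((r ^ 3 : ℝ) : ℂ) * Complex.exp (((3 : ℤ) : ℂ) * (θ * Complex.I)) = w at *
    have hgt : 1 < r ^ 3 := one_lt_pow₀ hr' (by norm_num)
    have hw0 : w ≠ 0 := by
      rintro rfl; simp at hn; linarith
    have hw1 : w - 1 ≠ 0 := by
      intro hw; rw [sub_eq_zero.mp hw] at hn; simp at hn; linarith
    have hw2 : 1 - w⁻¹ ≠ 0 := by
      intro hw; apply hw1; field_simp at hw; simpa using hw
    have hk : 3 * Complex.I * w / (w - 1) = ((3 : ℝ) : ℂ) * Complex.I +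
        -((-3 : ℤ) : ℂ) * Complex.I * w⁻¹ / (1 - w⁻¹) := by
      have : w⁻¹ / (1 - w⁻¹) = 1 / (w - 1) := by
        rw [div_eq_div_iff hw2 hw1]; field_simp
      rw [mul_div_assoc _ w⁻¹, this]
      push_cast
      field_simp
      ring
    rw [hk, Complex.add_im, Complex.im_ofReal_mul, Complex.I_im]
    field_simp
    ring

/-- The integral of the Liouville form over the round circle of radius r centered at 0:
it equals −6πr²/(1+r²) for r < 1 and 6π/(1+r²) for r > 1; in particular it never
vanishes, so no such circle is an exact loop. -/
theorem liouville_integral_over_centered_circles :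
    ∀ r : ℝ, 0 < r → r ≠ 1 →
      (∫ θ in (0:ℝ)..(2 * π),
          liouville ((r : ℂ) * Complex.exp (θ * Complex.I))
            ((r : ℂ) * Complex.I * Complex.exp (θ * Complex.I)))
        = (if r < 1 then -6 * π * r ^ 2 / (1 + r ^ 2) else 6 * π / (1 + r ^ 2)) ∧
      (∫ θ in (0:ℝ)..(2 * π),
          liouville ((r : ℂ) * Complex.exp (θ * Complex.I))
            ((r : ℂ) * Complex.I * Complex.exp (θ * Complex.I))) ≠ 0 := by
  intro r hr hr1
  have h := aux_main r hr hr1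
  refine ⟨h, ?_⟩
  rw [h]
  have hpi := Real.pi_pos
  split_ifs
  · have : 0 < 6 * π * r ^ 2 / (1 + r ^ 2) := by positivity
    intro h0
    have : -6 * π * r ^ 2 / (1 + r ^ 2) = -(6 * π * r ^ 2 / (1 + r ^ 2)) := by ring
    linarith
  · positivity
end

section
/- Let λ be the real 1-form on U = {z ∈ ℂ : z³ ≠ 1} given by λ_z(v) = −Im((3·conj(z)/(1 + |z|²) − 3z²/(z³ − 1))·v). For every r with 0 < r < √3, the integral of λ over the circle γ(θ) = 1 + r·e^{iθ} satisfies ∫₀^{2π} λ_{γ(θ)}(γ'(θ)) dθ = 2π − ∬_{B(1,r)} 6/(1 + |z|²)² dA(z), where B(1,r) is the open disc of radius r centered at 1 and dA is Lebesgue measure on ℂ. In particular such a circle is an exact loop if and only if the disc it bounds has weighted area ∬_{B(1,r)} 6/(1 + |z|²)² dA equal to 2π. -/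
open Complex Real MeasureTheory

noncomputable def DD (ρ θ : ℝ) : ℝ := 2 + ρ ^ 2 + 2 * ρ * Real.cos θ

lemma DD_pos (ρ θ : ℝ) : 0 < DD ρ θ := by
  unfold DD
  nlinarith [sq_nonneg (ρ + Real.cos θ), Real.sin_sq_add_cos_sq θ, sq_nonneg (Real.sin θ)]

lemma DD_cont : Continuous (fun p : ℝ × ℝ => DD p.1 p.2) := by
  unfold DD; fun_prop

lemma DD_one_add (ρ θ : ℝ) :
    1 + ‖1 + (ρ : ℂ) * Complex.exp (θ * Complex.I)‖ ^ 2 = DD ρ θ := by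
  rw [← Complex.normSq_eq_norm_sq, Complex.exp_mul_I, ← Complex.ofReal_cos, ← Complex.ofReal_sin,
    Complex.normSq_apply]
  simp [DD, -Complex.ofReal_cos, -Complex.ofReal_sin]
  nlinarith [Real.sin_sq_add_cos_sq θ]

noncomputable def GG (ρ θ : ℝ) : ℝ :=
  3 * (Real.cos θ * DD ρ θ + 2 * ρ * Real.sin θ ^ 2) / DD ρ θ ^ 2

lemma GG_cont : Continuous (fun p : ℝ × ℝ => GG p.1 p.2) := by
  unfold GG
  have := DD_cont
  exact Continuous.div (by fun_prop) (by fun_prop) (fun p => (pow_pos (DD_pos _ _) 2).ne')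

lemma KK_cont : Continuous (fun p : ℝ × ℝ => 6 * p.1 / DD p.1 p.2 ^ 2) := by
  have := DD_cont
  exact Continuous.div (by fun_prop) (by fun_prop) (fun p => (pow_pos (DD_pos _ _) 2).ne')

lemma deriv_r (ρ θ : ℝ) : HasDerivAt (fun ρ => 3 * (ρ * Real.cos θ + ρ ^ 2) / DD ρ θ)
    (6 * ρ / DD ρ θ ^ 2 + GG ρ θ) ρ := by
  have hD : HasDerivAt (fun ρ => DD ρ θ) (2 * ρ + 2 * Real.cos θ) ρ := by
    unfold DD
    have h := ((hasDerivAt_id ρ).pow 2).const_add 2 |>.add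
      (((hasDerivAt_id ρ).const_mul 2).mul_const (Real.cos θ))
    refine h.congr_deriv ?_
    simp
  have hN : HasDerivAt (fun ρ => 3 * (ρ * Real.cos θ + ρ ^ 2)) (3 * (Real.cos θ + 2 * ρ)) ρ := by
    have h := (((hasDerivAt_id ρ).mul_const (Real.cos θ)).add ((hasDerivAt_id ρ).pow 2)).const_mul 3
    refine h.congr_deriv ?_
    simp
  refine (hN.div hD (DD_pos ρ θ).ne').congr_deriv (Eq.symm ?_)
  unfold GG
  have h0 := (DD_pos ρ θ).ne'
  rw [← add_div]
  congr 1
  unfold DD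
  linear_combination (6 * ρ) * Real.sin_sq_add_cos_sq θ

lemma deriv_t (ρ θ : ℝ) : HasDerivAt (fun θ => 3 * Real.sin θ / DD ρ θ) (GG ρ θ) θ := by
  have hD : HasDerivAt (fun θ => DD ρ θ) (-(2 * ρ * Real.sin θ)) θ := by
    unfold DD
    have h := ((Real.hasDerivAt_cos θ).const_mul (2 * ρ)).const_add (2 + ρ ^ 2)
    refine h.congr_deriv ?_
    ring
  refine (((Real.hasDerivAt_sin θ).const_mul 3).div hD (DD_pos ρ θ).ne').congr_deriv (Eq.symm ?_)
  unfold GG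
  congr 1
  ring

lemma integ_box {f : ℝ × ℝ → ℝ} (hf : Continuous f) (a b c d : ℝ) :
    IntegrableOn f (Set.uIoc a b ×ˢ Set.uIoc c d) := by
  refine (hf.continuousOn.integrableOn_compact
    (isCompact_uIcc.prod isCompact_uIcc) : IntegrableOn f (Set.uIcc a b ×ˢ Set.uIcc c d)).mono_set ?_
  exact Set.prod_mono Set.uIoc_subset_uIcc Set.uIoc_subset_uIcc

lemma cont_one (F : ℝ → ℝ → ℝ) (h : Continuous fun p : ℝ × ℝ => F p.1 p.2) (θ : ℝ) :
    Continuous fun ρ => F ρ θ :=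
  h.comp (Continuous.prodMk continuous_id continuous_const)

lemma cont_two (F : ℝ → ℝ → ℝ) (h : Continuous fun p : ℝ × ℝ => F p.1 p.2) (ρ : ℝ) :
    Continuous fun θ => F ρ θ :=
  h.comp (Continuous.prodMk continuous_const continuous_id)

lemma stokes (r : ℝ) :
    ∫ θ in (-π)..π, 3 * (r * Real.cos θ + r ^ 2) / DD r θ
      = ∫ ρ in (0:ℝ)..r, ∫ θ in (-π)..π, 6 * ρ / DD ρ θ ^ 2 := by
  have hK := KK_cont
  have hG := GG_cont
  have e1 : ∀ θ, 3 * (r * Real.cos θ + r ^ 2) / DD r θ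
      = ∫ ρ in (0:ℝ)..r, (6 * ρ / DD ρ θ ^ 2 + GG ρ θ) := by
    intro θ
    rw [intervalIntegral.integral_eq_sub_of_hasDerivAt (fun x _ => deriv_r x θ)]
    · simp
    · have c1 : Continuous fun ρ => 6 * ρ / DD ρ θ ^ 2 :=
        cont_one (fun ρ θ => 6 * ρ / DD ρ θ ^ 2) hK θ
      have c2 : Continuous fun ρ => GG ρ θ :=
        cont_one GG hG θ
      exact (c1.add c2).intervalIntegrable _ _
  rw [intervalIntegral.integral_congr (fun θ _ => e1 θ)]
  rw [intervalIntegral_intervalIntegral_swap]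
  · apply intervalIntegral.integral_congr
    intro ρ _
    have c1 : Continuous fun θ => 6 * ρ / DD ρ θ ^ 2 :=
      cont_two (fun ρ θ => 6 * ρ / DD ρ θ ^ 2) hK ρ
    have c2 : Continuous fun θ => GG ρ θ :=
      cont_two GG hG ρ
    beta_reduce
    rw [intervalIntegral.integral_add (c1.intervalIntegrable _ _) (c2.intervalIntegrable _ _),
      intervalIntegral.integral_eq_sub_of_hasDerivAt (fun x _ => deriv_t ρ x)
        (c2.intervalIntegrable _ _)]
    simp
  · exact integ_box ((hK.add hG).comp continuous_swap) _ _ _ _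

lemma area (r : ℝ) (hr : 0 < r) :
    ∫ z in Metric.ball (1 : ℂ) r, 6 / (1 + ‖z‖ ^ 2) ^ 2
      = ∫ ρ in (0:ℝ)..r, ∫ θ in (-π)..π, 6 * ρ / DD ρ θ ^ 2 := by
  rw [← integral_indicator Metric.isOpen_ball.measurableSet,
    ← integral_add_left_eq_self _ (1 : ℂ), ← Complex.integral_comp_polarCoord_symm]
  have hs : MeasurableSet (Set.Ioo 0 r ×ˢ Set.Ioo (-π) π : Set (ℝ × ℝ)) :=
    measurableSet_Ioo.prod measurableSet_Ioo
  have ht : MeasurableSet (Set.Ioi 0 ×ˢ Set.Ioo (-π) π : Set (ℝ × ℝ)) :=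
    measurableSet_Ioi.prod measurableSet_Ioo
  have : ∫ p in polarCoord.target, p.1 • (Metric.ball (1 : ℂ) r).indicator
        (fun z => 6 / (1 + ‖z‖ ^ 2) ^ 2) (1 + Complex.polarCoord.symm p)
      = ∫ p in (Set.Ioo 0 r ×ˢ Set.Ioo (-π) π : Set (ℝ × ℝ)), 6 * p.1 / DD p.1 p.2 ^ 2 := by
    rw [polarCoord_target, ← integral_indicator hs, ← integral_indicator ht]
    congr 1
    ext ⟨ρ, θ⟩
    simp only [Set.indicator, Set.mem_prod, Set.mem_Ioi, Set.mem_Ioo, Metric.mem_ball,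
      dist_eq_norm, add_sub_cancel_left, Complex.norm_polarCoord_symm]
    by_cases h0 : 0 < ρ
    · rw [abs_of_pos h0]
      have : Complex.polarCoord.symm (ρ, θ) = (ρ : ℂ) * Complex.exp (θ * Complex.I) := by
        rw [Complex.polarCoord_symm_apply, Complex.exp_mul_I, Complex.ofReal_cos,
          Complex.ofReal_sin]
      rw [this, DD_one_add]
      by_cases h1 : ρ < r <;> by_cases h2 : -π < θ ∧ θ < π <;> simp [h0, h1, h2]
      ring
    · simp [h0]
  rw [this, Measure.volume_eq_prod, setIntegral_prod]
  · rw [intervalIntegral.integral_of_le hr.le, integral_Ioc_eq_integral_Ioo]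
    simp_rw [intervalIntegral.integral_of_le (by linarith [Real.pi_pos] : -π ≤ π),
      integral_Ioc_eq_integral_Ioo]
  · refine (integ_box KK_cont 0 r (-π) π).mono_set ?_
    rw [Set.uIoc_of_le hr.le, Set.uIoc_of_le (by linarith [Real.pi_pos] : -π ≤ π)]
    exact Set.prod_mono Set.Ioo_subset_Ioc_self Set.Ioo_subset_Ioc_self

lemma quad_ne (r : ℝ) (hr : 0 < r) (h3 : r < Real.sqrt 3) (z : ℂ)
    (hz : z ∈ Metric.closedBall (1 : ℂ) r) : z ^ 2 + z + 1 ≠ 0 := by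
  intro h
  rw [Metric.mem_closedBall, dist_eq_norm] at hz
  have hr2 : r ^ 2 < 3 := by
    have := Real.sq_sqrt (show (0:ℝ) ≤ 3 by norm_num)
    nlinarith
  have hz2 : ‖z - 1‖ ^ 2 < 3 := by nlinarith [norm_nonneg (z - 1)]
  rw [← Complex.normSq_eq_norm_sq, Complex.normSq_apply] at hz2
  have hre := congrArg Complex.re h
  have him := congrArg Complex.im h
  simp [pow_two] at hre him hz2
  have : z.im * (2 * z.re + 1) = 0 := by linarith
  rcases mul_eq_zero.1 this with h | h
  · rw [h] at hre; nlinarith [sq_nonneg (z.re + 1/2)]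
  · have : z.re = -1/2 := by linarith
    rw [this] at hre hz2
    nlinarith

lemma mero (r : ℝ) (hr : 0 < r) (h3 : r < Real.sqrt 3) :
    ∮ z in C(1, r), 3 * z ^ 2 / (z ^ 3 - 1) = 2 * π * Complex.I := by
  have hd : DifferentiableOn ℂ (fun z : ℂ => 3 * z ^ 2 / (z ^ 2 + z + 1))
      (Metric.closedBall (1 : ℂ) r) :=
    DifferentiableOn.div (by fun_prop) (by fun_prop) (quad_ne r hr h3)
  have := hd.circleIntegral_sub_inv_smul (Metric.mem_ball_self hr)
  convert this using 1
  · congr 1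
    ext z
    rw [smul_eq_mul, show z ^ 3 - 1 = (z - 1) * (z ^ 2 + z + 1) by ring, inv_mul_eq_div,
      div_div, mul_comm (z - 1)]
  · norm_num

lemma first_im (r θ : ℝ) :
    (3 * (starRingEnd ℂ) (1 + (r : ℂ) * Complex.exp (θ * Complex.I)) /
      ((1 + ‖1 + (r : ℂ) * Complex.exp (θ * Complex.I)‖ ^ 2 : ℝ) : ℂ) *
      ((r : ℂ) * Complex.I * Complex.exp (θ * Complex.I))).im
      = 3 * (r * Real.cos θ + r ^ 2) / DD r θ := by
  rw [DD_one_add, div_mul_eq_mul_div, Complex.div_ofReal_im, Complex.exp_mul_I,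
    ← Complex.ofReal_cos, ← Complex.ofReal_sin]
  congr 1
  simp [-Complex.ofReal_cos, -Complex.ofReal_sin]
  linear_combination (3 * r ^ 2) * Real.sin_sq_add_cos_sq θ

lemma main_eq (r : ℝ) (hr : 0 < r) (h3 : r < Real.sqrt 3) :
      (∫ θ in (0:ℝ)..(2 * π),
          liouville (1 + (r : ℂ) * Complex.exp (θ * Complex.I))
            ((r : ℂ) * Complex.I * Complex.exp (θ * Complex.I)))
        = 2 * π - ∫ z in Metric.ball (1 : ℂ) r, 6 / (1 + ‖z‖ ^ 2) ^ 2 := by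
  have e : ∀ θ : ℝ, liouville (1 + (r : ℂ) * Complex.exp (θ * Complex.I))
            ((r : ℂ) * Complex.I * Complex.exp (θ * Complex.I))
      = Complex.imCLM (deriv (circleMap 1 r) θ •
          (fun z : ℂ => 3 * z ^ 2 / (z ^ 3 - 1)) (circleMap 1 r θ))
        - 3 * (r * Real.cos θ + r ^ 2) / DD r θ := by
    intro θ
    rw [← first_im, deriv_circleMap, liouville, sub_mul, Complex.sub_im]
    simp only [circleMap, Complex.imCLM_apply, smul_eq_mul]
    rw [neg_sub]
    congr 2
    ring
  simp_rw [e]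
  have hci : CircleIntegrable (fun z : ℂ => 3 * z ^ 2 / (z ^ 3 - 1)) 1 r := by
    apply ContinuousOn.circleIntegrable hr.le
    refine ContinuousOn.div (by fun_prop) (by fun_prop) ?_
    intro z hz
    rw [show z ^ 3 - 1 = (z - 1) * (z ^ 2 + z + 1) by ring]
    refine mul_ne_zero ?_ (quad_ne r hr h3 z (Metric.sphere_subset_closedBall hz))
    intro h0
    rw [Metric.mem_sphere, dist_eq_norm, h0, norm_zero] at hz
    exact hr.ne hz
  have hc2 : Continuous fun θ => 3 * (r * Real.cos θ + r ^ 2) / DD r θ := by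
    have : Continuous fun θ => DD r θ :=
      DD_cont.comp (by fun_prop : Continuous fun θ : ℝ => (r, θ))
    exact Continuous.div (by fun_prop) this (fun θ => (DD_pos _ _).ne')
  have hii := hci.out
  rw [intervalIntegral.integral_sub _ (hc2.intervalIntegrable _ _),
    ContinuousLinearMap.intervalIntegral_comp_comm _ hii]
  · have hm := mero r hr h3
    rw [circleIntegral] at hm
    rw [hm, area r hr, ← stokes]
    congr 1
    · simp
    · have hp : Function.Periodic (fun θ => 3 * (r * Real.cos θ + r ^ 2) / DD r θ) (2 * π) := by
        intro θ; simp [DD]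
      have := hp.intervalIntegral_add_eq 0 (-π)
      rw [zero_add, show -π + 2 * π = π by ring] at this
      exact this
  · exact ⟨Complex.imCLM.integrable_comp hii.1, Complex.imCLM.integrable_comp hii.2⟩

/-- For 0 < r < √3 the integral of the Liouville form over the circle 1 + r·e^{iθ}
equals 2π minus the weighted area ∬_{B(1,r)} 6/(1+|z|²)² dA; in particular the circle is
an exact loop iff that weighted area equals 2π. -/
theorem liouville_integral_over_circles_around_one :
    ∀ r : ℝ, 0 < r → r < Real.sqrt 3 →
      (∫ θ in (0:ℝ)..(2 * π),
          liouville (1 + (r : ℂ) * Complex.exp (θ * Complex.I))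
            ((r : ℂ) * Complex.I * Complex.exp (θ * Complex.I)))
        = 2 * π - ∫ z in Metric.ball (1 : ℂ) r, 6 / (1 + ‖z‖ ^ 2) ^ 2 ∧
      ((∫ θ in (0:ℝ)..(2 * π),
          liouville (1 + (r : ℂ) * Complex.exp (θ * Complex.I))
            ((r : ℂ) * Complex.I * Complex.exp (θ * Complex.I))) = 0 ↔
        (∫ z in Metric.ball (1 : ℂ) r, 6 / (1 + ‖z‖ ^ 2) ^ 2) = 2 * π) := by
  intro r hr h3
  refine ⟨main_eq r hr h3, ?_⟩
  rw [main_eq r hr h3, sub_eq_zero, eq_comm]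
end

section
/- There exists r with 0 < r < √3 such that ∬_{B(1,r)} 6/(1 + |z|²)² dA(z) = 2π, where B(1,r) is the open disc of radius r centered at 1 ∈ ℂ and dA is Lebesgue measure. Consequently there exists a round circle centered at the zero p = 1 of z³ − 1, enclosing no other cube root of unity, which is an exact loop for the Liouville form λ on the complement U = {z ∈ ℂ : z³ ≠ 1}. -/
open Complex Real MeasureTheory

theorem aux_I1 (a b D u : ℝ) (hD : 0 < D) (h : D ^ 2 = a ^ 2 - b ^ 2) (ha : 0 < a)
    (hu : Real.sin u = 0) :
    (∫ θ in u..(u + 2 * π), 1 / (a + b * Real.cos θ)) = 2 * π / D := by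
  have hab : |b| < a := by
    apply abs_lt_of_sq_lt_sq _ ha.le
    nlinarith
  have hpos : ∀ θ, 0 < a + b * Real.cos θ := by
    intro θ
    have h1 : |b * Real.cos θ| ≤ |b| := by
      rw [abs_mul]
      exact mul_le_of_le_one_right (abs_nonneg _) (Real.abs_cos_le_one θ)
    have := neg_abs_le (b * Real.cos θ)
    linarith
  have hderiv : ∀ θ : ℝ, HasDerivAt
      (fun θ => (θ - 2 * Real.arctan (b * Real.sin θ / (a + D + b * Real.cos θ))) / D)
      (1 / (a + b * Real.cos θ)) θ := by
    intro θ
    have hp := hpos θ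
    have hq : 0 < a + D + b * Real.cos θ := by linarith
    have h1 := (((Real.hasDerivAt_sin θ).const_mul b).div
      (((Real.hasDerivAt_cos θ).const_mul b).const_add (a + D)) hq.ne').arctan
    have h2 := ((hasDerivAt_id θ).sub (h1.const_mul 2)).div_const D
    refine h2.congr_deriv ?_
    have hs : Real.sin θ ^ 2 = 1 - Real.cos θ ^ 2 := by rw [Real.sin_sq]
    have hsum : (a + D + b * Real.cos θ) ^ 2 + (b * Real.sin θ) ^ 2
        = 2 * (a + D) * (a + b * Real.cos θ) := by
      have : b ^ 2 = a ^ 2 - D ^ 2 := by linarith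
      rw [mul_pow, hs]; linear_combination this
    have e1 : 1 + (b * Real.sin θ / (a + D + b * Real.cos θ)) ^ 2
        = 2 * (a + D) * (a + b * Real.cos θ) / (a + D + b * Real.cos θ) ^ 2 := by
      rw [← hsum]; field_simp
    simp only [Pi.div_apply]
    rw [e1]
    have hne := hp.ne'
    have hqe := hq.ne'
    have haD : a + D ≠ 0 := by positivity
    field_simp
    ring_nf
    rw [hs]
    have h3 : b ^ 2 = a ^ 2 - D ^ 2 := by linarith
    ring_nf
    try simp only [h3]
    ring_nf
  rw [intervalIntegral.integral_eq_sub_of_hasDerivAt (fun θ _ => hderiv θ)]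
  · simp [hu]; field_simp; ring
  · apply Continuous.intervalIntegrable
    exact continuous_const.div (by fun_prop) (fun θ => (hpos θ).ne')

theorem aux_I2 (a b D u : ℝ) (hD : 0 < D) (h : D ^ 2 = a ^ 2 - b ^ 2) (ha : 0 < a)
    (hu : Real.sin u = 0) :
    (∫ θ in u..(u + 2 * π), 1 / (a + b * Real.cos θ) ^ 2) = 2 * π * a / D ^ 3 := by
  have hab : |b| < a := by
    apply abs_lt_of_sq_lt_sq _ ha.le
    nlinarith
  have hpos : ∀ θ, 0 < a + b * Real.cos θ := by
    intro θ
    have h1 : |b * Real.cos θ| ≤ |b| := by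
      rw [abs_mul]
      exact mul_le_of_le_one_right (abs_nonneg _) (Real.abs_cos_le_one θ)
    have := neg_abs_le (b * Real.cos θ)
    linarith
  have hderiv : ∀ θ : ℝ, HasDerivAt
      (fun θ => b * (Real.sin θ / (a + b * Real.cos θ)))
      (a * (1 / (a + b * Real.cos θ)) - D ^ 2 * (1 / (a + b * Real.cos θ) ^ 2)) θ := by
    intro θ
    have hp := (hpos θ).ne'
    refine (((Real.hasDerivAt_sin θ).div
      (((Real.hasDerivAt_cos θ).const_mul b).const_add a) hp).const_mul b).congr_deriv ?_
    have hs : Real.sin θ ^ 2 = 1 - Real.cos θ ^ 2 := by rw [Real.sin_sq]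
    field_simp
    rw [h]
    linear_combination b ^ 2 * hs
  have i1 : IntervalIntegrable (fun θ => 1 / (a + b * Real.cos θ)) volume u (u + 2 * π) := by
    apply Continuous.intervalIntegrable
    exact continuous_const.div (by fun_prop) (fun θ => (hpos θ).ne')
  have i2 : IntervalIntegrable (fun θ => 1 / (a + b * Real.cos θ) ^ 2) volume u (u + 2 * π) := by
    apply Continuous.intervalIntegrable
    exact continuous_const.div (by fun_prop) (fun θ => pow_ne_zero 2 (hpos θ).ne')
  have h0 := intervalIntegral.integral_eq_sub_of_hasDerivAt (fun θ _ => hderiv θ)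
    ((i1.const_mul a).sub (i2.const_mul (D ^ 2)))
  rw [intervalIntegral.integral_sub (i1.const_mul a) (i2.const_mul (D ^ 2)),
    intervalIntegral.integral_const_mul, intervalIntegral.integral_const_mul,
    aux_I1 a b D u hD h ha hu] at h0
  simp [hu] at h0
  simp only [one_div]
  rw [eq_div_iff (by positivity)]
  have : a * (2 * π / D) * D = a * (2 * π) := by field_simp
  linear_combination -D * h0 + this

theorem aux_area (r : ℝ) (hr : 0 < r) :
    (∫ z in Metric.ball (1 : ℂ) r, 6 / (1 + ‖z‖ ^ 2) ^ 2)
      = 3 * π * (r ^ 2 - 2) / √(r ^ 4 + 4) + 3 * π := by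
  have hnorm : ∀ ρ θ : ℝ, 1 + ‖(1 : ℂ) + Complex.polarCoord.symm (ρ, θ)‖ ^ 2
      = (2 + ρ ^ 2) + 2 * ρ * Real.cos θ := by
    intro ρ θ
    rw [← Complex.normSq_eq_norm_sq, Complex.normSq_apply, Complex.polarCoord_symm_apply]
    simp [← Complex.ofReal_cos, ← Complex.ofReal_sin]
    linear_combination ρ ^ 2 * Real.sin_sq_add_cos_sq θ
  have hpos : ∀ ρ θ : ℝ, 0 < (2 + ρ ^ 2) + 2 * ρ * Real.cos θ := by
    intro ρ θ
    rw [← hnorm]; positivity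
  have step1 : (∫ z in Metric.ball (1 : ℂ) r, 6 / (1 + ‖z‖ ^ 2) ^ 2)
      = ∫ w : ℂ, (Metric.ball (0 : ℂ) r).indicator (fun w => 6 / (1 + ‖1 + w‖ ^ 2) ^ 2) w := by
    rw [← integral_indicator Metric.isOpen_ball.measurableSet]
    rw [← integral_add_left_eq_self _ (1 : ℂ)]
    congr 1
    ext w
    by_cases hw : w ∈ Metric.ball (0 : ℂ) r
    · rw [Set.indicator_of_mem hw, Set.indicator_of_mem]
      simpa [dist_eq_norm] using hw
    · rw [Set.indicator_of_notMem hw, Set.indicator_of_notMem]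
      simpa [dist_eq_norm] using hw
  rw [step1, ← Complex.integral_comp_polarCoord_symm]
  have step2 : (∫ p in polarCoord.target, p.1 •
      (Metric.ball (0 : ℂ) r).indicator (fun w => 6 / (1 + ‖1 + w‖ ^ 2) ^ 2)
        (Complex.polarCoord.symm p))
      = ∫ p in Set.Ioo 0 r ×ˢ Set.Ioo (-π) π,
        p.1 * 6 * (1 / ((2 + p.1 ^ 2) + 2 * p.1 * Real.cos p.2) ^ 2) := by
    rw [← integral_indicator polarCoord.open_target.measurableSet,
      ← integral_indicator (measurableSet_Ioo.prod measurableSet_Ioo)]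
    congr 1
    ext ⟨ρ, θ⟩
    simp only [Set.indicator, polarCoord_target, Set.mem_prod, Set.mem_Ioi, Set.mem_Ioo,
      Metric.mem_ball, dist_zero_right, Complex.norm_polarCoord_symm, hnorm]
    by_cases h1 : 0 < ρ
    · simp only [h1, abs_of_pos h1, true_and]
      by_cases h2 : ρ < r <;> simp [h2] <;> intros <;> ring
    · simp [h1]
  rw [step2, Measure.volume_eq_prod, setIntegral_prod]
  · have inner : ∀ ρ : ℝ, (∫ θ in Set.Ioo (-π) π,
        ρ * 6 * (1 / ((2 + ρ ^ 2) + 2 * ρ * Real.cos θ) ^ 2))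
        = ρ * 6 * (2 * π * (2 + ρ ^ 2) / √(ρ ^ 4 + 4) ^ 3) := by
      intro ρ
      have := aux_I2 (2 + ρ ^ 2) (2 * ρ) √(ρ ^ 4 + 4) (-π) (by positivity)
        (by rw [Real.sq_sqrt (by positivity)]; ring) (by positivity) (by simp)
      rw [show -π + 2 * π = π by ring] at this
      rw [← integral_Ioc_eq_integral_Ioo,
        ← intervalIntegral.integral_of_le (by linarith [Real.pi_pos]),
        intervalIntegral.integral_const_mul, this]
    simp only [inner]
    rw [← integral_Ioc_eq_integral_Ioo, ← intervalIntegral.integral_of_le hr.le]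
    have hderiv : ∀ ρ : ℝ, HasDerivAt (fun ρ => 3 * π * (ρ ^ 2 - 2) / √(ρ ^ 4 + 4))
        (ρ * 6 * (2 * π * (2 + ρ ^ 2) / √(ρ ^ 4 + 4) ^ 3)) ρ := by
      intro ρ
      have hs : 0 < √(ρ ^ 4 + 4) := by positivity
      have hsq : √(ρ ^ 4 + 4) ^ 2 = ρ ^ 4 + 4 := Real.sq_sqrt (by positivity)
      have h1 := ((((hasDerivAt_pow 2 ρ).sub_const 2).const_mul (3 * π)).div
        (((hasDerivAt_pow 4 ρ).add_const 4).sqrt (by positivity)) hs.ne')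
      refine h1.congr_deriv ?_
      generalize √(ρ ^ 4 + 4) = s at *
      field_simp
      rw [hsq]
      push_cast
      ring
    rw [intervalIntegral.integral_eq_sub_of_hasDerivAt (fun ρ _ => hderiv ρ)]
    · have : √(4 : ℝ) = 2 := by
        rw [show (4 : ℝ) = 2 ^ 2 by norm_num]; exact Real.sqrt_sq (by norm_num)
      simp [this]
      ring
    · apply Continuous.intervalIntegrable
      refine Continuous.mul (by fun_prop) (Continuous.div (by fun_prop) (by fun_prop) ?_)
      intro ρ; positivity
  · have hc : Continuous (fun p : ℝ × ℝ =>
        p.1 * 6 * (1 / ((2 + p.1 ^ 2) + 2 * p.1 * Real.cos p.2) ^ 2)) := by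
      refine Continuous.mul (by fun_prop) (Continuous.div (by fun_prop) (by fun_prop) ?_)
      intro p
      exact pow_ne_zero 2 (hpos _ _).ne'
    rw [← Measure.volume_eq_prod]
    refine (hc.continuousOn.integrableOn_compact
      (isCompact_Icc.prod isCompact_Icc : IsCompact (Set.Icc 0 r ×ˢ Set.Icc (-π) π))).mono_set ?_
    exact Set.prod_mono Set.Ioo_subset_Icc_self Set.Ioo_subset_Icc_self

theorem aux_ne (r : ℝ) (hr3 : r ^ 2 < 3) (hr : 0 < r) (z : ℂ) (hz : ‖z - 1‖ ≤ r) :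
    z ^ 2 + z + 1 ≠ 0 := by
  intro h
  have hn : ‖z - 1‖ ^ 2 < 3 := by nlinarith [norm_nonneg (z - 1)]
  rw [← Complex.normSq_eq_norm_sq, Complex.normSq_apply] at hn
  have h1 := congrArg Complex.re h
  have h2 := congrArg Complex.im h
  simp [pow_two] at h1 h2 hn
  have h3 : z.im * (2 * z.re + 1) = 0 := by linarith
  rcases mul_eq_zero.mp h3 with h4 | h4
  · rw [h4] at h1
    nlinarith [sq_nonneg (z.re + 1 / 2)]
  · have : z.re = -1 / 2 := by linarith
    rw [this] at h1 hn
    nlinarith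

theorem aux_loop (r : ℝ) (hr : 0 < r) (hr3 : r ^ 2 < 3) :
    (∫ θ in (0:ℝ)..(2 * π),
          liouville (1 + (r : ℂ) * Complex.exp (θ * Complex.I))
            ((r : ℂ) * Complex.I * Complex.exp (θ * Complex.I)))
      = 2 * π - (3 * π * (r ^ 2 - 2) / √(r ^ 4 + 4) + 3 * π) := by
  have hsph : ∀ z ∈ Metric.sphere (1 : ℂ) r, z - 1 ≠ 0 ∧ z ^ 2 + z + 1 ≠ 0 := by
    intro z hz
    rw [mem_sphere_iff_norm] at hz
    refine ⟨?_, aux_ne r hr3 hr z hz.le⟩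
    rw [← norm_pos_iff, hz]; exact hr
  have hc2 : ContinuousOn (fun z : ℂ => (2 * z + 1) / (z ^ 2 + z + 1)) (Metric.sphere 1 r) :=
    ContinuousOn.div (by fun_prop) (by fun_prop) (fun z hz => (hsph z hz).2)
  have hc1 : ContinuousOn (fun z : ℂ => (z - 1)⁻¹) (Metric.sphere 1 r) :=
    ContinuousOn.inv₀ (by fun_prop) (fun z hz => (hsph z hz).1)
  have hcirc : (∮ z in C((1 : ℂ), r), 3 * z ^ 2 / (z ^ 3 - 1)) = 2 * π * Complex.I := by
    have e : (∮ z in C((1 : ℂ), r), 3 * z ^ 2 / (z ^ 3 - 1))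
        = ∮ z in C((1 : ℂ), r), ((z - 1)⁻¹ + (2 * z + 1) / (z ^ 2 + z + 1)) := by
      apply circleIntegral.integral_congr hr.le
      intro z hz
      obtain ⟨h1, h2⟩ := hsph z hz
      have h3 : z ^ 3 - 1 = (z - 1) * (z ^ 2 + z + 1) := by ring
      simp only [h3]
      rw [inv_eq_one_div, div_add_div _ _ h1 h2]
      congr 1
      ring
    rw [e, circleIntegral.integral_add (hc1.circleIntegrable hr.le) (hc2.circleIntegrable hr.le),
      circleIntegral.integral_sub_center_inv _ hr.ne']
    rw [Complex.circleIntegral_eq_zero_of_differentiable_on_off_countable hr.le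
      Set.countable_empty, add_zero]
    · refine ContinuousOn.div (by fun_prop) (by fun_prop) (fun z hz => aux_ne r hr3 hr z ?_)
      simpa [dist_eq_norm] using hz
    · intro z hz
      refine DifferentiableAt.div (by fun_prop) (by fun_prop) (aux_ne r hr3 hr z ?_)
      have := hz.1
      rw [Metric.mem_ball, dist_eq_norm] at this
      exact this.le
  have hcf : ContinuousOn (fun z : ℂ => 3 * z ^ 2 / (z ^ 3 - 1)) (Metric.sphere 1 r) := by
    refine ContinuousOn.div (by fun_prop) (by fun_prop) (fun z hz => ?_)
    obtain ⟨h1, h2⟩ := hsph z hz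
    have h3 : z ^ 3 - 1 = (z - 1) * (z ^ 2 + z + 1) := by ring
    rw [h3]; exact mul_ne_zero h1 h2
  have hint := (hcf.circleIntegrable hr.le).out
  have him : (∫ θ in (0:ℝ)..(2 * π), (deriv (circleMap 1 r) θ •
      (fun z : ℂ => 3 * z ^ 2 / (z ^ 3 - 1)) (circleMap 1 r θ)).im) = 2 * π := by
    have := Complex.imCLM.intervalIntegral_comp_comm hint
    simp only [Complex.imCLM_apply] at this
    rw [this]
    rw [circleIntegral] at hcirc
    rw [hcirc]
    simp
  have himint : IntervalIntegrable (fun θ => (deriv (circleMap 1 r) θ •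
      (fun z : ℂ => 3 * z ^ 2 / (z ^ 3 - 1)) (circleMap 1 r θ)).im) volume 0 (2 * π) :=
    ⟨Complex.imCLM.integrable_comp hint.1, Complex.imCLM.integrable_comp hint.2⟩
  have hn : ∀ θ : ℝ, 1 + ‖1 + (r : ℂ) * Complex.exp (θ * Complex.I)‖ ^ 2
      = (2 + r ^ 2) + 2 * r * Real.cos θ := by
    intro θ
    rw [← Complex.normSq_eq_norm_sq, Complex.normSq_apply, Complex.exp_mul_I]
    simp [← Complex.ofReal_cos, ← Complex.ofReal_sin]
    linear_combination r ^ 2 * Real.sin_sq_add_cos_sq θ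
  have hpos : ∀ θ : ℝ, 0 < (2 + r ^ 2) + 2 * r * Real.cos θ := by
    intro θ
    rw [← hn]; positivity
  have key : ∀ θ : ℝ, liouville (1 + (r : ℂ) * Complex.exp (θ * Complex.I))
            ((r : ℂ) * Complex.I * Complex.exp (θ * Complex.I))
      = (deriv (circleMap 1 r) θ •
      (fun z : ℂ => 3 * z ^ 2 / (z ^ 3 - 1)) (circleMap 1 r θ)).im
        - (3 / 2 + (3 * (r ^ 2 - 2) / 2) * (1 / ((2 + r ^ 2) + 2 * r * Real.cos θ))) := by
    intro θ
    unfold liouville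
    rw [hn, deriv_circleMap]
    simp only [circleMap, zero_add, smul_eq_mul]
    rw [sub_mul, Complex.sub_im]
    have e2 : (3 * (starRingEnd ℂ) (1 + (r : ℂ) * Complex.exp (θ * Complex.I)) /
        (((2 + r ^ 2) + 2 * r * Real.cos θ : ℝ) : ℂ) *
          ((r : ℂ) * Complex.I * Complex.exp (θ * Complex.I))).im
        = 3 / 2 + (3 * (r ^ 2 - 2) / 2) * (1 / ((2 + r ^ 2) + 2 * r * Real.cos θ)) := by
      rw [div_mul_eq_mul_div, Complex.div_ofReal_im]
      have : (3 * (starRingEnd ℂ) (1 + (r : ℂ) * Complex.exp (θ * Complex.I)) *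
          ((r : ℂ) * Complex.I * Complex.exp (θ * Complex.I))).im
          = 3 * (r * Real.cos θ + r ^ 2) := by
        rw [Complex.exp_mul_I, ← Complex.ofReal_cos, ← Complex.ofReal_sin]
        simp [-Complex.ofReal_cos, -Complex.ofReal_sin]
        linear_combination 3 * r ^ 2 * Real.sin_sq_add_cos_sq θ
      rw [this]
      have h5 := (hpos θ).ne'
      rw [div_eq_iff h5, add_mul, mul_assoc (3 * (r ^ 2 - 2) / 2), one_div, inv_mul_cancel₀ h5]
      ring
    rw [e2]
    rw [show ∀ w : ℂ, w * ((r : ℂ) * Complex.I * Complex.exp (θ * Complex.I))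
      = (r : ℂ) * Complex.exp (θ * Complex.I) * Complex.I * w from fun w => by ring]
    ring
  simp only [key]
  have i1 : IntervalIntegrable (fun θ => 1 / ((2 + r ^ 2) + 2 * r * Real.cos θ))
      volume 0 (2 * π) := by
    apply Continuous.intervalIntegrable
    exact continuous_const.div (by fun_prop) (fun θ => (hpos θ).ne')
  have hI1 := aux_I1 (2 + r ^ 2) (2 * r) √(r ^ 4 + 4) 0 (by positivity)
        (by rw [Real.sq_sqrt (by positivity)]; ring) (by positivity) (by simp)
  rw [zero_add] at hI1
  rw [intervalIntegral.integral_sub himint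
    ((intervalIntegrable_const).add (i1.const_mul _)), him,
    intervalIntegral.integral_add intervalIntegrable_const (i1.const_mul _),
    intervalIntegral.integral_const_mul, hI1, intervalIntegral.integral_const]
  simp
  ring

/-- There is a radius 0 < r < √3 for which the disc B(1,r) has weighted area
∬ 6/(1+|z|²)² dA = 2π; the corresponding round circle around the zero p = 1 (enclosing
no other cube root of unity) is an exact loop for the Liouville form. -/
theorem exists_exact_circle_around_one :
    ∃ r : ℝ, 0 < r ∧ r < Real.sqrt 3 ∧
      (∫ z in Metric.ball (1 : ℂ) r, 6 / (1 + ‖z‖ ^ 2) ^ 2) = 2 * π ∧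
      (∫ θ in (0:ℝ)..(2 * π),
          liouville (1 + (r : ℂ) * Complex.exp (θ * Complex.I))
            ((r : ℂ) * Complex.I * Complex.exp (θ * Complex.I))) = 0 := by
  have h17 : √(17 : ℝ) ^ 2 = 17 := Real.sq_sqrt (by norm_num)
  have hlo : 4 < √(17 : ℝ) := by
    rw [Real.lt_sqrt (by norm_num)]; norm_num
  have hhi : √(17 : ℝ) < 5 := by
    rw [Real.sqrt_lt' (by norm_num)]; norm_num
  have hs0 : 0 < (9 - √(17 : ℝ)) / 4 := by linarith
  have hr : 0 < √((9 - √(17 : ℝ)) / 4) := Real.sqrt_pos.mpr hs0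
  have hr2 : √((9 - √(17 : ℝ)) / 4) ^ 2 = (9 - √(17 : ℝ)) / 4 := Real.sq_sqrt hs0.le
  have hval : ∀ r : ℝ, r ^ 2 = (9 - √(17 : ℝ)) / 4 →
      3 * π * (r ^ 2 - 2) / √(r ^ 4 + 4) + 3 * π = 2 * π := by
    intro r h
    have : √(r ^ 4 + 4) = 3 * (2 - r ^ 2) := by
      rw [Real.sqrt_eq_iff_mul_self_eq (by positivity) (by rw [h]; linarith)]
      rw [show r ^ 4 = (r ^ 2) ^ 2 by ring, h]
      nlinarith
    rw [this, h]
    have h2 : 2 - (9 - √(17 : ℝ)) / 4 ≠ 0 := by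
      have : 0 < 2 - (9 - √(17 : ℝ)) / 4 := by linarith
      exact this.ne'
    have h3 : 3 * π * ((9 - √(17 : ℝ)) / 4 - 2) / (3 * (2 - (9 - √(17 : ℝ)) / 4)) = -π := by
      rw [div_eq_iff (mul_ne_zero (by norm_num) h2)]; ring
    rw [h3]; ring
  refine ⟨√((9 - √(17 : ℝ)) / 4), hr, ?_, ?_, ?_⟩
  · exact Real.sqrt_lt_sqrt hs0.le (by linarith)
  · rw [aux_area _ hr, hval _ hr2]
  · rw [aux_loop _ hr (by rw [hr2]; linarith), hval _ hr2]; ring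
end
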